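/- Let S ⊂ ℝ be a finite set and ε > 0, and suppose no two elements r, s ∈ S satisfy r − s ∈ [ε,2ε). Then S admits a partition into nonempty pairwise disjoint subsets R₁, …, R_m such that for all r ∈ R_i and s ∈ R_j: if i < j then r − s ≤ −2ε; if i = j then |r − s| < ε; and if i > j then r − s ≥ 2ε. -/

import Mathlib

/-! The partition of the support used in the proof of Lemma 2.6.6 of Seidel,
"A long exact sequence for symplectic Floer cohomology": a finite set of reals with no
two elements differing by an amount in [ε,2ε) can be partitioned into clusters of
diameter < ε, any two distinct clusters being at distance ≥ 2ε (in a monotone order). -/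

theorem support_partition (S : Finset ℝ) (ε : ℝ) (hε : 0 < ε)
    (hgap : ∀ r ∈ S, ∀ s ∈ S, r - s ∉ Set.Ico ε (2*ε)) :
    ∃ (m : ℕ) (R : Fin m → Finset ℝ),
      (∀ i, (R i).Nonempty) ∧
      (∀ i j, i ≠ j → Disjoint (R i) (R j)) ∧
      (S = Finset.univ.biUnion R) ∧
      (∀ i j, ∀ r ∈ R i, ∀ s ∈ R j,
        (i < j → r - s ≤ -(2*ε)) ∧ (i = j → |r - s| < ε) ∧ (j < i → 2*ε ≤ r - s)) := by
  induction S using Finset.strongInduction with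
  | H S ih =>
    rcases S.eq_empty_or_nonempty with rfl | hS
    · exact ⟨0, Fin.elim0, fun i => i.elim0, fun i => i.elim0, by simp, fun i => i.elim0⟩
    · obtain ⟨a, ha, hmin⟩ := S.exists_min_image id hS
      simp only [id] at hmin
      have hsub : S.filter (fun s => ¬ s - a < ε) ⊂ S :=
        Finset.filter_ssubset.2 ⟨a, ha, by simpa using hε⟩
      obtain ⟨m, R, hne, hdisj, hunion, hR⟩ := ih _ hsub fun r hr s hs =>
        hgap r (hsub.1 hr) s (hsub.1 hs)
      have hmem : ∀ x, (x ∈ S ∧ ¬ x - a < ε) ↔ ∃ j, x ∈ R j := fun x => by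
        simpa only [Finset.mem_filter, Finset.mem_biUnion, Finset.mem_univ, true_and] using
          Finset.ext_iff.1 hunion x
      have hsep : ∀ r ∈ S.filter (fun s => s - a < ε), ∀ j, ∀ s ∈ R j, 2 * ε ≤ s - r := by
        intro r hr j s hs
        obtain ⟨hrS, hra⟩ := Finset.mem_filter.1 hr
        obtain ⟨hsS, hsa⟩ := (hmem s).2 ⟨j, hs⟩
        have hfar : 2 * ε ≤ s - a := by
          by_contra! h
          exact hgap s hsS a ha ⟨not_lt.1 hsa, h⟩
        by_contra! h
        exact hgap s hsS r hrS ⟨by linarith, h⟩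
      have hdisj₀ : ∀ j, Disjoint (S.filter (fun s => s - a < ε)) (R j) := fun j =>
        Finset.disjoint_left.2 fun x hx hxj => by
          have := hsep x hx j x hxj
          linarith
      refine ⟨m + 1, Fin.cons (S.filter (fun s => s - a < ε)) R, ?_, ?_, ?_, ?_⟩
      · intro i
        cases i using Fin.cases with
        | zero => exact ⟨a, by simpa using ⟨ha, hε⟩⟩
        | succ i => exact hne i
      · intro i j hij
        cases i using Fin.cases with
        | zero =>
          cases j using Fin.cases with
          | zero => exact absurd rfl hij
          | succ j => exact hdisj₀ j
        | succ i =>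
          cases j using Fin.cases with
          | zero => exact (hdisj₀ i).symm
          | succ j => exact hdisj i j fun h => hij (congrArg Fin.succ h)
      · ext x
        simp only [Finset.mem_biUnion, Finset.mem_univ, true_and, Fin.exists_fin_succ,
          Fin.cons_zero, Fin.cons_succ, Finset.mem_filter, ← hmem]
        tauto
      · intro i j r hr s hs
        cases i using Fin.cases with
        | zero =>
          cases j using Fin.cases with
          | zero =>
            obtain ⟨hrS, hra⟩ := Finset.mem_filter.1 hr
            obtain ⟨hsS, hsa⟩ := Finset.mem_filter.1 hs
            have hr₀ := hmin r hrS
            have hs₀ := hmin s hsS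
            exact ⟨fun h => absurd h (lt_irrefl _),
              fun _ => abs_lt.2 ⟨by linarith, by linarith⟩, fun h => absurd h (lt_irrefl _)⟩
          | succ j =>
            have h := hsep r hr j s hs
            exact ⟨fun _ => by linarith, fun h => absurd h.symm (Fin.succ_ne_zero j),
              fun h => absurd h (Fin.not_lt_zero _)⟩
        | succ i =>
          cases j using Fin.cases with
          | zero =>
            exact ⟨fun h => absurd h (Fin.not_lt_zero _),
              fun h => absurd h (Fin.succ_ne_zero i), fun _ => hsep s hs i r hr⟩
          | succ j =>
            simpa only [Fin.succ_lt_succ_iff, Fin.succ_inj] using hR i j r hr s hs
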